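/- Let (G,S) be an essential set-equipped graph, and let C_G denote the collection of all nonempty sets of pairwise vertex-disjoint cycles in G. If λ is the least positive solution of the equation Σ_{C ∈ C_G} (−1)^{|C|+1} Π_{c ∈ C} H_c(x) = 1, where H_c(x) denotes the product of H_i(x) over the vertices i of the cycle c, then the topological entropy of X(G,S) equals log(1/λ). -/

import Mathlib

open Filter Topology

/-- The shift map on bi-infinite sequences over the alphabet `A`. -/
def shiftMap {A : Type*} (x : ℤ → A) : ℤ → A := fun i => x (i + 1)

/-- A finite word `w` appears (as a consecutive subsequence) in the bi-infinite
sequence `x`. -/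
def Appears {A : Type*} (w : List A) (x : ℤ → A) : Prop :=
  ∃ k : ℤ, ∀ i : Fin w.length, x (k + (i : ℕ)) = w.get i

/-- `w` belongs to the language of `X`: it appears in some point of `X`. -/
def InLanguage {A : Type*} (X : Set (ℤ → A)) (w : List A) : Prop :=
  ∃ x ∈ X, Appears w x

/-- `X` has topological entropy `h`, i.e. `(1/n) · log |B_n(X)| → h`. -/
def HasEntropy {A : Type*} (X : Set (ℤ → A)) (h : ℝ) : Prop :=
  Filter.Tendsto
    (fun n : ℕ => Real.log ({w : List A | w.length = n ∧ InLanguage X w}.ncard) / n)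
    Filter.atTop (nhds h)

/-- The set of bi-infinite concatenations `⋯ u₋₁^{n₋₁} u₀^{n₀} u₁^{n₁} ⋯` with
`uᵢ ∈ V`, `nᵢ ∈ S uᵢ` and `(uᵢ, uᵢ₊₁)` an edge of the graph.  The `S`-graph shift
`X(G,S)` is the closure of this set. -/
def SGraphCore {V : Type*} (Adj : V → V → Prop) (S : V → Set ℕ) : Set (ℤ → V) :=
  {x | ∃ (a : ℤ → V) (t : ℤ → ℤ), StrictMono t ∧
    (∀ i : ℤ, (t (i + 1) - t i).toNat ∈ S (a i)) ∧
    (∀ i : ℤ, Adj (a i) (a (i + 1))) ∧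
    (∀ i k : ℤ, t i ≤ k → k < t (i + 1) → x k = a i) ∧
    (∀ m : ℤ, ∃ i : ℤ, t i ≤ m ∧ m < t (i + 1))}

/-- The generating function `H_i(x) = ∑_{s ∈ S i} x^s` of a vertex `i`. -/
noncomputable def genFun {V : Type*} (S : V → Set ℕ) (i : V) (x : ℝ) : ℝ :=
  ∑' s : S i, x ^ (s : ℕ)

/-- The sum `∑_{C ∈ C_G} (−1)^{|C|+1} ∏_{c ∈ C} H_c(x)` over all nonempty sets `C`
of pairwise vertex-disjoint cycles of `G`.  A nonempty set of pairwise
vertex-disjoint cycles of `G` is encoded, in the standard way, as a permutation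
`π ≠ 1` of the vertices all of whose non-fixed points `i` satisfy
`Adj i (π i)`; the number `|C|` of cycles in the set is the number of cycles of
`π` (the length of its cycle type), and `∏_{c ∈ C} H_c(x)` is the product of
`H_i(x)` over the support of `π`. -/
noncomputable def cycleSum {V : Type*} [Fintype V] [DecidableEq V]
    (Adj : V → V → Prop) (S : V → Set ℕ) (x : ℝ) : ℝ :=
  open scoped Classical in
  ∑ π ∈ Finset.univ.filter
      (fun π : Equiv.Perm V => π ≠ 1 ∧ ∀ i, π i ≠ i → Adj i (π i)),
    (-1 : ℝ) ^ (π.cycleType.card + 1) * ∏ i ∈ π.support, genFun S i x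

section MatrixPowers

open scoped Matrix.Norms.Operator

variable {V : Type*} [Fintype V] [DecidableEq V]

lemma Matrix.abs_apply_le_linfty_norm (A : Matrix V V ℝ) (u v : V) : |A u v| ≤ ‖A‖ := by
  rw [Matrix.linfty_opNorm_def]
  have h1 : ‖A u v‖₊ ≤ ∑ j, ‖A u j‖₊ :=
    Finset.single_le_sum (f := fun j => ‖A u j‖₊) (fun _ _ => zero_le) (Finset.mem_univ v)
  have h2 : ∑ j, ‖A u j‖₊ ≤ Finset.univ.sup fun i => ∑ j, ‖A i j‖₊ :=
    Finset.le_sup (f := fun i => ∑ j, ‖A i j‖₊) (Finset.mem_univ u)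
  have h3 : ‖A u v‖₊ ≤ Finset.univ.sup fun i => ∑ j, ‖A i j‖₊ := h1.trans h2
  exact_mod_cast h3

/-- If a power of a nonnegative matrix `A` has norm less than one and `C` bounds the norm of
`(1 - A)⁻¹`, then all partial Neumann sums of `A` are bounded by `2 * C`. -/
lemma Matrix.sum_pow_apply_le {A : Matrix V V ℝ} (hA : ∀ u v, 0 ≤ A u v)
    (hdet : (1 - A).det ≠ 0) {C : ℝ} (hC : ‖(1 - A)⁻¹‖ ≤ C) {k : ℕ} (hk : 0 < k)
    (hAk : ‖A ^ k‖ < 1) (K : ℕ) (u v : V) :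
    (∑ j ∈ Finset.range K, A ^ j) u v ≤ 2 * C := by
  have hC0 : 0 ≤ C := (norm_nonneg _).trans hC
  have hone : ‖(1 : Matrix V V ℝ)‖ ≤ 1 := by
    rw [Matrix.linfty_opNorm_def]
    have : (Finset.univ.sup fun i => ∑ j, ‖(1 : Matrix V V ℝ) i j‖₊) ≤ 1 := by
      refine Finset.sup_le fun i _ => ?_
      rw [Finset.sum_eq_single i]
      · simp
      · intro j _ hj
        simp [Matrix.one_apply_ne hj.symm]
      · simp
    exact_mod_cast this
  have hmono : (∑ j ∈ Finset.range K, A ^ j) u v ≤ (∑ j ∈ Finset.range (k * K), A ^ j) u v := by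
    rw [Matrix.sum_apply, Matrix.sum_apply]
    refine Finset.sum_le_sum_of_subset_of_nonneg ?_ fun j _ _ => pow_apply_nonneg hA j u v
    exact Finset.range_subset_range.2 (Nat.le_mul_of_pos_left K hk)
  have hpow : ‖A ^ (k * K)‖ ≤ 1 := by
    rw [pow_mul]
    clear hmono
    induction K with
    | zero => simpa using hone
    | succ n ih =>
      rw [pow_succ]
      exact (norm_mul_le _ _).trans (mul_le_one₀ ih (norm_nonneg _) hAk.le)
  have hgeom : ∑ j ∈ Finset.range (k * K), A ^ j = (1 - A)⁻¹ * (1 - A ^ (k * K)) := by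
    rw [← mul_neg_geom_sum, ← mul_assoc, Matrix.nonsing_inv_mul _ (Ne.isUnit hdet), one_mul]
  calc (∑ j ∈ Finset.range K, A ^ j) u v
      ≤ (∑ j ∈ Finset.range (k * K), A ^ j) u v := hmono
    _ ≤ ‖∑ j ∈ Finset.range (k * K), A ^ j‖ :=
        (le_abs_self _).trans (Matrix.abs_apply_le_linfty_norm _ u v)
    _ ≤ ‖(1 - A)⁻¹‖ * ‖1 - A ^ (k * K)‖ := by rw [hgeom]; exact norm_mul_le _ _
    _ ≤ C * 2 := by
        refine mul_le_mul hC ?_ (norm_nonneg _) hC0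
        exact (norm_sub_le _ _).trans (by linarith)
    _ = 2 * C := mul_comm _ _

/-- Along a continuous path of nonnegative matrices starting at `0` for which `1 - M x` stays
invertible, the Neumann series converges up to the end point. -/
lemma Matrix.summable_pow_of_det_ne_zero {M : ℝ → Matrix V V ℝ} {b : ℝ} (hb : 0 ≤ b)
    (hM : ContinuousOn M (Set.Icc 0 b)) (hnn : ∀ x ∈ Set.Icc 0 b, ∀ u v, 0 ≤ M x u v)
    (h0 : M 0 = 0) (hdet : ∀ x ∈ Set.Icc 0 b, (1 - M x).det ≠ 0) (u v : V) :
    Summable fun k => (M b ^ k) u v := by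
  have hsub : ContinuousOn (fun x => 1 - M x) (Set.Icc 0 b) := continuousOn_const.sub hM
  have hinv : ContinuousOn (fun x => (1 - M x)⁻¹) (Set.Icc 0 b) := by
    simp only [Matrix.inv_def, Ring.inverse_eq_inv']
    exact ((continuous_id.matrix_det.comp_continuousOn hsub).inv₀ hdet).smul
      (continuous_id.matrix_adjugate.comp_continuousOn hsub)
  obtain ⟨C, hC⟩ := isCompact_Icc.exists_bound_of_continuousOn hinv
  set s : Set ℝ := {x | ∀ K u v, (∑ j ∈ Finset.range K, M x ^ j) u v ≤ 2 * C}
  have hsummable : ∀ x ∈ s, x ∈ Set.Icc 0 b → ∀ u v, Summable fun k => (M x ^ k) u v := by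
    intro x hx hxb u v
    refine summable_of_sum_range_le (c := 2 * C)
      (fun k => Matrix.pow_apply_nonneg (hnn x hxb) k u v) fun K => ?_
    have := hx K u v
    rwa [Matrix.sum_apply] at this
  have hclosed : IsClosed (s ∩ Set.Icc 0 b) := by
    have : s ∩ Set.Icc 0 b = ⋂ (K : ℕ) (u : V) (v : V),
        Set.Icc 0 b ∩ (fun x => (∑ j ∈ Finset.range K, M x ^ j) u v) ⁻¹' Set.Iic (2 * C) ∩
          Set.Icc 0 b := by
      ext x
      simp only [s, Set.mem_inter_iff, Set.mem_ofPred_eq, Set.mem_iInter, Set.mem_preimage,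
        Set.mem_Iic]
      exact ⟨fun h K u v => ⟨⟨h.2, h.1 K u v⟩, h.2⟩,
        fun h => ⟨fun K u v => (h K u v).1.2, (h 0 u v).2⟩⟩
    rw [this]
    refine isClosed_iInter fun K => isClosed_iInter fun u => isClosed_iInter fun v => ?_
    refine IsClosed.inter ?_ isClosed_Icc
    refine ContinuousOn.preimage_isClosed_of_isClosed ?_ isClosed_Icc isClosed_Iic
    have h1 : ContinuousOn (fun x => ∑ j ∈ Finset.range K, M x ^ j) (Set.Icc 0 b) :=
      continuousOn_finsetSum _ fun j _ => hM.pow j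
    exact (continuous_id.matrix_elem u v).comp_continuousOn h1
  have hmem : ∀ x ∈ Set.Icc 0 b, ∀ k : ℕ, 0 < k → ‖M x ^ k‖ < 1 → x ∈ s :=
    fun x hx k hk hlt K u v =>
      Matrix.sum_pow_apply_le (hnn x hx) (hdet x hx) (hC x hx) hk hlt K u v
  have hIcc : Set.Icc 0 b ⊆ s := by
    refine hclosed.Icc_subset_of_forall_exists_gt ?_ ?_
    · exact hmem 0 ⟨le_rfl, hb⟩ 1 one_pos (by simp [h0])
    · rintro x ⟨hxs, hx0, hxb⟩ y hy
      have hxI : x ∈ Set.Icc 0 b := ⟨hx0, hxb.le⟩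
      have ht : Tendsto (fun k => M x ^ k) atTop (𝓝 0) := by
        refine tendsto_pi_nhds.2 fun u => tendsto_pi_nhds.2 fun v => ?_
        exact (hsummable x hxs hxI u v).tendsto_atTop_zero
      have ht' : Tendsto (fun k => ‖M x ^ k‖) atTop (𝓝 0) := by
        simpa using ht.norm
      obtain ⟨k, hk1, hk⟩ :=
        ((ht'.eventually_lt_const one_pos).and (eventually_gt_atTop 0)).exists
      have hc : ContinuousWithinAt (fun y => ‖M y ^ k‖) (Set.Icc 0 b) x :=
        ((hM.pow k).norm) x hxI
      have hev : ∀ᶠ z in 𝓝[>] x, ‖M z ^ k‖ < 1 := by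
        have h1 : ∀ᶠ z in 𝓝[Set.Icc 0 b] x, ‖M z ^ k‖ < 1 := hc.eventually_lt_const hk1
        have h2 : 𝓝[Set.Ioc x b] x ≤ 𝓝[Set.Icc 0 b] x :=
          nhdsWithin_mono _ fun z hz => ⟨hx0.trans hz.1.le, hz.2⟩
        have h3 := h2 h1
        rwa [nhdsWithin_Ioc_eq_nhdsGT hxb] at h3
      have hmin : x < min y b := lt_min hy hxb
      obtain ⟨z, hz, hzI⟩ := (hev.and (Ioc_mem_nhdsGT hmin)).exists
      have hzb : z ∈ Set.Icc 0 b := ⟨hx0.trans hzI.1.le, hzI.2.trans (min_le_right _ _)⟩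
      exact ⟨z, hmem z hzb k hk hz, hzI.1, hzI.2.trans (min_le_left _ _)⟩
  exact hsummable b (hIcc ⟨hb, le_rfl⟩) ⟨hb, le_rfl⟩ u v

end MatrixPowers

section CyclePolynomial

variable {V : Type*}

/-- The matrix with entry `H v` at each edge `u → v`, and `0` elsewhere. -/
noncomputable def edgeMatrix (Adj : V → V → Prop) (H : V → ℝ) : Matrix V V ℝ :=
  open scoped Classical in
  Matrix.of fun u v => if Adj u v then H v else 0

variable [Fintype V] [DecidableEq V]

open scoped Classical in
lemma det_one_sub_edgeMatrix {Adj : V → V → Prop} (hLoop : ∀ v, ¬ Adj v v) (H : V → ℝ) :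
    (1 - edgeMatrix Adj H).det = 1 - ∑ π ∈ Finset.univ.filter
      (fun π : Equiv.Perm V => π ≠ 1 ∧ ∀ i, π i ≠ i → Adj i (π i)),
        (-1 : ℝ) ^ (π.cycleType.card + 1) * ∏ i ∈ π.support, H i := by
  have hterm : ∀ π : Equiv.Perm V,
      ((Equiv.Perm.sign π : ℤ) : ℝ) * ∏ i, (1 - edgeMatrix Adj H) i (π i) =
        if ∀ i, π i ≠ i → Adj i (π i) then
          (-1 : ℝ) ^ π.cycleType.card * ∏ i ∈ π.support, H i else 0 := by
    intro π
    have hprod : ∏ i, (1 - edgeMatrix Adj H) i (π i) =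
        ∏ i ∈ π.support, -(if Adj i (π i) then H (π i) else 0) := by
      symm
      refine Finset.prod_subset_one_on_sdiff (Finset.subset_univ _) ?_ ?_
      · intro i hi
        have hi' : π i = i := by simpa using hi
        simp [hi', edgeMatrix, hLoop]
      · intro i hi
        have hi' : π i ≠ i := by simpa using hi
        simp [edgeMatrix, Matrix.one_apply_ne hi'.symm]
    rw [hprod]
    split_ifs with h
    · have h1 : ∏ i ∈ π.support, -(if Adj i (π i) then H (π i) else 0) =
          (-1) ^ π.support.card * ∏ i ∈ π.support, H i := by
        rw [Finset.prod_neg]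
        congr 1
        rw [← Equiv.Perm.prod_comp π π.support H (by intro i hi; simpa using hi)]
        exact Finset.prod_congr rfl fun i hi => if_pos (h i (by simpa using hi))
      rw [h1, Equiv.Perm.sign_of_cycleType, Equiv.Perm.sum_cycleType]
      push_cast
      rw [← mul_assoc, ← pow_add]
      congr 1
      rw [show π.support.card + π.cycleType.card + π.support.card =
        2 * π.support.card + π.cycleType.card by ring, pow_add, pow_mul]
      simp
    · push Not at h
      obtain ⟨i, hi, hA⟩ := h
      rw [Finset.prod_eq_zero (i := i) (by simpa using hi) (by simp [hA]), mul_zero]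
  rw [← Matrix.det_transpose, Matrix.det_apply']
  simp only [Matrix.transpose_apply]
  rw [Finset.sum_congr rfl fun π _ => hterm π, ← Finset.add_sum_erase _ _ (Finset.mem_univ 1)]
  rw [← Finset.sum_filter, sub_eq_add_neg, ← Finset.sum_neg_distrib]
  congr 1
  · simp
  · refine Finset.sum_congr ?_ fun π _ => by ring
    ext π
    simp

end CyclePolynomial

section GeneratingFunctions

variable {V : Type*} {S : V → Set ℕ}

lemma summable_pow_subtype (T : Set ℕ) {x : ℝ} (h0 : 0 ≤ x) (h1 : x < 1) :
    Summable fun s : T => x ^ (s : ℕ) :=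
  (summable_geometric_of_lt_one h0 h1).subtype T

lemma genFun_nonneg (v : V) {x : ℝ} (h0 : 0 ≤ x) : 0 ≤ genFun S v x :=
  tsum_nonneg fun _ => pow_nonneg h0 _

lemma genFun_zero (hPos : ∀ v, 0 ∉ S v) (v : V) : genFun S v 0 = 0 := by
  have h : ∀ s : S v, (0 : ℝ) ^ (s : ℕ) = 0 := fun s =>
    zero_pow fun h => hPos v (h ▸ s.2)
  simp [genFun, h]

lemma continuousOn_genFun (v : V) {b : ℝ} (hb : b < 1) :
    ContinuousOn (genFun S v) (Set.Icc 0 b) := by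
  rcases lt_or_ge b 0 with h | h0
  · simp [Set.Icc_eq_empty_of_lt h]
  refine continuousOn_tsum (u := fun s : S v => b ^ (s : ℕ))
    (fun s => (continuous_pow _).continuousOn) (summable_pow_subtype _ h0 hb) ?_
  intro s x hx
  rw [Real.norm_of_nonneg (pow_nonneg hx.1 _)]
  exact pow_le_pow_left₀ hx.1 hx.2 _

lemma continuous_genFun_of_finite {v : V} (h : (S v).Finite) : Continuous (genFun S v) := by
  have := h.fintype
  have h1 : genFun S v = fun x => ∑ s : S v, x ^ (s : ℕ) := by
    funext x
    exact tsum_fintype _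
  rw [h1]
  fun_prop

lemma sum_pow_le_genFun {v : V} {F : Finset ℕ} (hF : ↑F ⊆ S v) {x : ℝ} (h0 : 0 ≤ x)
    (hs : Summable fun s : S v => x ^ (s : ℕ)) : ∑ s ∈ F, x ^ s ≤ genFun S v x := by
  classical
  have h := hs.sum_le_tsum (F.subtype (· ∈ S v)) fun s _ => pow_nonneg h0 _
  rwa [Finset.sum_subtype_of_mem (fun s : ℕ => x ^ s) fun s hs => hF hs] at h

lemma pow_le_genFun {v : V} {s : ℕ} (hsv : s ∈ S v) {x : ℝ} (h0 : 0 ≤ x)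
    (hs : Summable fun s : S v => x ^ (s : ℕ)) : x ^ s ≤ genFun S v x := by
  simpa using sum_pow_le_genFun (F := {s}) (by simpa using hsv) h0 hs

end GeneratingFunctions

section LeastSolution

variable {V : Type*} {Adj : V → V → Prop}

lemma edgeMatrix_nonneg {H : V → ℝ} (hH : ∀ v, 0 ≤ H v) (u v : V) :
    0 ≤ edgeMatrix Adj H u v := by
  simp only [edgeMatrix, Matrix.of_apply]
  split_ifs
  exacts [hH v, le_rfl]

lemma edgeMatrix_apply_of_adj (H : V → ℝ) {u v : V} (h : Adj u v) :
    edgeMatrix Adj H u v = H v := by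
  simp [edgeMatrix, h]

variable [Fintype V] [DecidableEq V]

lemma summable_edgeMatrix_pow {H : V → ℝ → ℝ} {b : ℝ} (hb : 0 ≤ b)
    (hc : ∀ v, ContinuousOn (H v) (Set.Icc 0 b)) (hnn : ∀ v, ∀ x ∈ Set.Icc 0 b, 0 ≤ H v x)
    (h0 : ∀ v, H v 0 = 0)
    (hdet : ∀ x ∈ Set.Ioc 0 b, (1 - edgeMatrix Adj fun v => H v x).det ≠ 0) (u v : V) :
    Summable fun k => ((edgeMatrix Adj fun v => H v b) ^ k) u v := by
  have hzero : (edgeMatrix Adj fun v => H v 0) = 0 := by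
    ext u v
    simp [edgeMatrix, h0]
  refine Matrix.summable_pow_of_det_ne_zero (M := fun x => edgeMatrix Adj fun v => H v x)
    hb ?_ (fun x hx => edgeMatrix_nonneg fun v => hnn v x hx) hzero ?_ u v
  · refine continuousOn_pi.2 fun u => continuousOn_pi.2 fun v => ?_
    by_cases h : Adj u v
    · simpa [edgeMatrix, h] using hc v
    · simpa [edgeMatrix, h] using continuousOn_const
  · intro x hx
    rcases hx.1.eq_or_lt with rfl | h
    · simp [hzero]
    · exact hdet x ⟨h, hx.2⟩

lemma det_one_sub_edgeMatrix_genFun (hLoop : ∀ v, ¬ Adj v v) (S : V → Set ℕ) (x : ℝ) :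
    (1 - edgeMatrix Adj fun v => genFun S v x).det = 1 - cycleSum Adj S x :=
  det_one_sub_edgeMatrix hLoop _

lemma Matrix.one_le_pow_pow_apply_self {A : Matrix V V ℝ} (hA : ∀ u v, 0 ≤ A u v) {m : ℕ} {i : V}
    (h : 1 ≤ (A ^ m) i i) (k : ℕ) : 1 ≤ (A ^ (m * k)) i i := by
  induction k with
  | zero => simp
  | succ k ih =>
    rw [Nat.mul_succ, pow_add, Matrix.mul_apply]
    refine le_trans ?_ (Finset.single_le_sum (f := fun j => (A ^ (m * k)) i j * (A ^ m) j i)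
      (fun j _ => mul_nonneg (Matrix.pow_apply_nonneg hA _ _ _)
        (Matrix.pow_apply_nonneg hA _ _ _)) (Finset.mem_univ i))
    exact one_le_mul_of_one_le_of_one_le ih h

lemma prod_le_edgeMatrix_pow_apply {H : V → ℝ} (hH : ∀ v, 0 ≤ H v) {π : Equiv.Perm V} {i : V}
    (hπ : ∀ n : ℕ, Adj ((π ^ n) i) ((π ^ (n + 1)) i)) (m : ℕ) :
    ∏ k ∈ Finset.range m, H ((π ^ (k + 1)) i) ≤ (edgeMatrix Adj H ^ m) i ((π ^ m) i) := by
  induction m with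
  | zero => simp
  | succ m ih =>
    rw [Finset.prod_range_succ, pow_succ (edgeMatrix Adj H), Matrix.mul_apply]
    refine le_trans ?_ (Finset.single_le_sum (f := fun j => (edgeMatrix Adj H ^ m) i j *
      edgeMatrix Adj H j ((π ^ (m + 1)) i))
      (fun j _ => mul_nonneg (Matrix.pow_apply_nonneg (edgeMatrix_nonneg hH) _ _ _)
        (edgeMatrix_nonneg hH _ _)) (Finset.mem_univ ((π ^ m) i)))
    rw [edgeMatrix_apply_of_adj H (hπ m)]
    exact mul_le_mul_of_nonneg_right ih (hH _)

/-- If a vertex on a cycle has an infinite set of run lengths, then the Neumann series of the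
edge matrix diverges at some point of `(0, 1)`. -/
lemma exists_not_summable_of_infinite {S : V → Set ℕ} (hNe : ∀ v, (S v).Nonempty)
    {π : Equiv.Perm V} (hπ : ∀ i, π i ≠ i → Adj i (π i)) {i : V} (hi : π i ≠ i)
    (hinf : (S i).Infinite) : ∃ x ∈ Set.Ioo (0 : ℝ) 1,
      ¬ Summable fun k => ((edgeMatrix Adj fun v => genFun S v x) ^ k) i i := by
  choose s hs using hNe
  obtain ⟨F, hF, hcard⟩ := hinf.exists_subset_card_eq 2
  obtain ⟨m, hm⟩ : ∃ m, orderOf π = m + 1 :=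
    Nat.exists_eq_succ_of_ne_zero (orderOf_pos π).ne'
  have hmove : ∀ n : ℕ, π ((π ^ n) i) ≠ (π ^ n) i := by
    intro n h
    rw [← Equiv.Perm.mul_apply, ← pow_succ', pow_succ, Equiv.Perm.mul_apply] at h
    exact hi ((π ^ n).injective h)
  have hadj : ∀ n : ℕ, Adj ((π ^ n) i) ((π ^ (n + 1)) i) := by
    intro n
    rw [pow_succ', Equiv.Perm.mul_apply]
    exact hπ _ (hmove n)
  have hret : (π ^ (m + 1)) i = i := by
    rw [← hm, pow_orderOf_eq_one, Equiv.Perm.one_apply]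
  set g : ℝ → ℝ := fun x =>
    (∏ k ∈ Finset.range m, x ^ s ((π ^ (k + 1)) i)) * ∑ a ∈ F, x ^ a
  have hg : Continuous g := by fun_prop
  have hg1 : 1 < g 1 := by
    simp [g, hcard]
  have hev : ∀ᶠ x in 𝓝[<] (1 : ℝ), 1 < g x :=
    (hg.continuousAt.tendsto.mono_left nhdsWithin_le_nhds).eventually_const_lt hg1
  obtain ⟨x, hx, hxI⟩ := (hev.and (Ioo_mem_nhdsLT (zero_lt_one' ℝ))).exists
  refine ⟨x, hxI, fun hsum => ?_⟩
  have hsumm : ∀ v, Summable fun s : S v => x ^ (s : ℕ) := fun v =>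
    summable_pow_subtype _ hxI.1.le hxI.2
  have hnn : ∀ v, 0 ≤ genFun S v x := fun v => genFun_nonneg v hxI.1.le
  have hle : 1 ≤ ((edgeMatrix Adj fun v => genFun S v x) ^ (m + 1)) i i := by
    have h := prod_le_edgeMatrix_pow_apply hnn hadj (m + 1)
    rw [hret, Finset.prod_range_succ, hret] at h
    refine hx.le.trans (le_trans ?_ h)
    refine mul_le_mul ?_ (sum_pow_le_genFun hF hxI.1.le (hsumm i))
      (Finset.sum_nonneg fun _ _ => pow_nonneg hxI.1.le _) (Finset.prod_nonneg fun _ _ => hnn _)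
    exact Finset.prod_le_prod (fun _ _ => pow_nonneg hxI.1.le _)
      fun k _ => pow_le_genFun (hs _) hxI.1.le (hsumm _)
  have ht : Tendsto (fun k => (m + 1) * k) atTop atTop :=
    tendsto_id.const_mul_atTop' (Nat.succ_pos m)
  have hlim := hsum.tendsto_atTop_zero.comp ht
  have := ge_of_tendsto' hlim fun k =>
    Matrix.one_le_pow_pow_apply_self (edgeMatrix_nonneg hnn) hle k
  exact absurd this (by norm_num)

lemma exists_not_summable_of_one_le {H : V → ℝ} [Nonempty V] (hH : ∀ v, 1 ≤ H v)
    (hOut : ∀ v, ∃ w, Adj v w) : ∃ u v, ¬ Summable fun k => (edgeMatrix Adj H ^ k) u v := by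
  by_contra! hsum
  have hH0 : ∀ v, 0 ≤ H v := fun v => zero_le_one.trans (hH v)
  have hone : ∀ (k : ℕ) (u : V), 1 ≤ ∑ v, (edgeMatrix Adj H ^ k) u v := by
    intro k
    induction k with
    | zero => intro u; simp [Matrix.one_apply]
    | succ k ih =>
      intro u
      obtain ⟨w, hw⟩ := hOut u
      simp only [pow_succ', Matrix.mul_apply]
      rw [Finset.sum_comm]
      simp only [← Finset.mul_sum]
      refine le_trans ?_ (Finset.single_le_sum
        (f := fun j => edgeMatrix Adj H u j * ∑ v, (edgeMatrix Adj H ^ k) j v)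
        (fun j _ => mul_nonneg (edgeMatrix_nonneg hH0 _ _)
          (zero_le_one.trans (ih j))) (Finset.mem_univ w))
      rw [edgeMatrix_apply_of_adj H hw]
      exact one_le_mul_of_one_le_of_one_le (hH w) (ih w)
  obtain ⟨u⟩ := ‹Nonempty V›
  have hlim : Tendsto (fun k => ∑ v, (edgeMatrix Adj H ^ k) u v) atTop (𝓝 (∑ _v : V, 0)) :=
    tendsto_finsetSum _ fun v _ => (hsum u v).tendsto_atTop_zero
  have := ge_of_tendsto' hlim fun k => hone k u
  simp at this
  linarith

/-- The equation `cycleSum Adj S x = 1` has a solution in `(0, 1]`. -/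
lemma exists_cycleSum_eq_one [Nonempty V] {S : V → Set ℕ} (hLoop : ∀ v, ¬ Adj v v)
    (hNe : ∀ v, (S v).Nonempty) (hPos : ∀ v, 0 ∉ S v) (hOut : ∀ v, ∃ w, Adj v w) :
    ∃ x ∈ Set.Ioc (0 : ℝ) 1, cycleSum Adj S x = 1 := by
  classical
  by_contra! hne
  by_cases hfin : ∀ i, (∃ π : Equiv.Perm V, (∀ j, π j ≠ j → Adj j (π j)) ∧ π i ≠ i) →
      (S i).Finite
  · set H : V → ℝ → ℝ := fun v x => if (S v).Finite then genFun S v x else x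
    have hHc : ∀ v, Continuous (H v) := by
      intro v
      by_cases h : (S v).Finite
      · simpa [H, h] using continuous_genFun_of_finite h
      · simpa [H, h] using continuous_id'
    have hH0 : ∀ v x, 0 ≤ x → 0 ≤ H v x := by
      intro v x hx
      simp only [H]
      split_ifs
      exacts [genFun_nonneg v hx, hx]
    have hHz : ∀ v, H v 0 = 0 := by
      intro v
      simp only [H]
      split_ifs
      exacts [genFun_zero hPos v, rfl]
    have hH1 : ∀ v, 1 ≤ H v 1 := by
      intro v
      simp only [H]
      split_ifs with h
      · obtain ⟨s, hs⟩ := hNe v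
        have := h.to_subtype
        simpa using pow_le_genFun hs zero_le_one Summable.of_finite
      · exact le_rfl
    have hdet : ∀ x ∈ Set.Ioc (0 : ℝ) 1, (1 - edgeMatrix Adj fun v => H v x).det ≠ 0 := by
      intro x hx
      have heq : (1 - edgeMatrix Adj fun v => H v x).det = 1 - cycleSum Adj S x := by
        rw [det_one_sub_edgeMatrix hLoop, cycleSum]
        congr 1
        refine Finset.sum_congr rfl fun π hπ => ?_
        congr 1
        refine Finset.prod_congr rfl fun i hi => ?_
        have hπ' := (Finset.mem_filter.1 hπ).2.2
        simp [H, hfin i ⟨π, hπ', by simpa using hi⟩]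
      rw [heq, sub_ne_zero]
      exact (hne x hx).symm
    obtain ⟨u, v, huv⟩ := exists_not_summable_of_one_le (H := fun v => H v 1) hH1 hOut
    exact huv (summable_edgeMatrix_pow zero_le_one (fun v => (hHc v).continuousOn)
      (fun v x hx => hH0 v x hx.1) hHz hdet u v)
  · push Not at hfin
    obtain ⟨i, ⟨π, hπ, hi⟩, hinf⟩ := hfin
    obtain ⟨x, hx, hns⟩ := exists_not_summable_of_infinite hNe hπ hi hinf
    refine hns (summable_edgeMatrix_pow (H := fun v x => genFun S v x) hx.1.le
      (fun v => continuousOn_genFun v hx.2) (fun v y hy => genFun_nonneg v hy.1)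
      (genFun_zero hPos) (fun y hy => ?_) i i)
    rw [det_one_sub_edgeMatrix_genFun hLoop, sub_ne_zero]
    exact (hne y ⟨hy.1, hy.2.trans hx.2.le⟩).symm

end LeastSolution

section BlockPaths

variable {V : Type*} {Adj : V → V → Prop} {S : V → Set ℕ}

/-- The word `u₀^{n₀} u₁^{n₁} ⋯` spelled by a list of blocks `(u₀, n₀), (u₁, n₁), …`. -/
def blockWord (l : List (V × ℕ)) : List V :=
  l.flatMap fun p => List.replicate p.2 p.1

/-- A list of blocks following the edges of the graph, with admissible run lengths. -/
def IsBlockPath (Adj : V → V → Prop) (S : V → Set ℕ) (l : List (V × ℕ)) : Prop :=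
  l.IsChain (fun p q => Adj p.1 q.1) ∧ ∀ p ∈ l, p.2 ∈ S p.1

@[simp] lemma blockWord_nil : blockWord ([] : List (V × ℕ)) = [] := rfl

@[simp] lemma blockWord_cons (p : V × ℕ) (l : List (V × ℕ)) :
    blockWord (p :: l) = List.replicate p.2 p.1 ++ blockWord l := rfl

lemma blockWord_append (l l' : List (V × ℕ)) :
    blockWord (l ++ l') = blockWord l ++ blockWord l' := by
  simp [blockWord]

lemma isBlockPath_cons {p : V × ℕ} {l : List (V × ℕ)} :
    IsBlockPath Adj S (p :: l) ↔
      p.2 ∈ S p.1 ∧ (∀ q ∈ l.head?, Adj p.1 q.1) ∧ IsBlockPath Adj S l := by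
  simp only [IsBlockPath, List.isChain_cons, List.forall_mem_cons]
  tauto

lemma head?_blockWord (hPos : ∀ v, 0 ∉ S v) {l : List (V × ℕ)} (hl : IsBlockPath Adj S l) :
    (blockWord l).head? = l.head?.map Prod.fst := by
  cases l with
  | nil => rfl
  | cons p l =>
    obtain ⟨u, n⟩ := p
    obtain ⟨n, rfl⟩ := Nat.exists_eq_succ_of_ne_zero
      (fun h : n = 0 => hPos u (h ▸ (isBlockPath_cons.1 hl).1))
    simp [List.replicate_succ]

lemma blockWord_injOn (hLoop : ∀ v, ¬ Adj v v) (hPos : ∀ v, 0 ∉ S v) :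
    Set.InjOn blockWord {l | IsBlockPath Adj S l} := by
  have hlt : ∀ (u : V) (n n' : ℕ) (l l' : List (V × ℕ)), IsBlockPath Adj S ((u, n) :: l) →
      n < n' → blockWord ((u, n) :: l) ≠ blockWord ((u, n') :: l') := by
    intro u n n' l l' hl hn heq
    obtain ⟨d, rfl⟩ := Nat.exists_eq_add_of_lt hn
    simp only [blockWord_cons] at heq
    rw [Nat.add_assoc, List.replicate_add, List.append_assoc, List.append_cancel_left_eq,
      List.replicate_succ] at heq
    have hl' := isBlockPath_cons.1 hl
    have hhead := head?_blockWord hPos hl'.2.2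
    rw [heq] at hhead
    cases l with
    | nil => simp at hhead
    | cons q l =>
      have : u = q.1 := by simpa using hhead
      have h2 : Adj u q.1 := hl'.2.1 q (by simp)
      exact hLoop u (by rwa [← this] at h2)
  intro l hl l' hl' heq
  induction l generalizing l' with
  | nil =>
    have h := head?_blockWord hPos hl'
    rw [← heq] at h
    cases l' with
    | nil => rfl
    | cons p l' => simp at h
  | cons p l ih =>
    have h := head?_blockWord hPos hl'
    rw [← heq, head?_blockWord hPos hl] at h
    cases l' with
    | nil => simp at h
    | cons p' l' =>
      obtain ⟨u, n⟩ := p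
      obtain ⟨u', n'⟩ := p'
      obtain rfl : u = u' := by simpa using h
      rcases lt_trichotomy n n' with hn | rfl | hn
      · exact (hlt u n n' l l' hl hn heq).elim
      · rw [ih (isBlockPath_cons.1 hl).2.2 (isBlockPath_cons.1 hl').2.2 (by simpa using heq)]
      · exact (hlt u n' n l' l hl' hn heq.symm).elim

/-- The word of length `n` read off `x` from position `k` on. -/
def seqWord (x : ℤ → V) (k : ℤ) (n : ℕ) : List V :=
  (List.range n).map fun r => x (k + (r : ℕ))

lemma seqWord_add (x : ℤ → V) (k : ℤ) (m n : ℕ) :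
    seqWord x k (m + n) = seqWord x k m ++ seqWord x (k + m) n := by
  simp [seqWord, List.range_add, add_assoc, Function.comp_def]

lemma seqWord_eq_replicate {x : ℤ → V} {k : ℤ} {n : ℕ} {u : V}
    (h : ∀ j, k ≤ j → j < k + n → x j = u) : seqWord x k n = List.replicate n u := by
  refine List.eq_replicate_iff.2 ⟨by simp [seqWord], fun b hb => ?_⟩
  obtain ⟨r, hr, rfl⟩ := List.mem_map.1 hb
  have := List.mem_range.1 hr
  exact h _ (by omega) (by omega)

lemma appears_iff {w : List V} {x : ℤ → V} : Appears w x ↔ ∃ k, w = seqWord x k w.length := by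
  refine exists_congr fun k => ⟨fun h => ?_, fun h i => ?_⟩
  · refine List.ext_get (by simp [seqWord]) fun n h1 h2 => ?_
    simpa [seqWord] using (h ⟨n, h1⟩).symm
  · have h1 : w.get i = (seqWord x k w.length).get ⟨i, by simp [seqWord]⟩ := by
      simp only [List.get_eq_getElem]
      exact List.getElem_of_eq h i.2
    rw [h1]
    simp [seqWord]

lemma seqWord_appears (x : ℤ → V) (k : ℤ) (n : ℕ) : Appears (seqWord x k n) x :=
  appears_iff.2 ⟨k, by simp [seqWord]⟩

lemma seqWord_eq_blockWord {x a : ℤ → V} {t : ℤ → ℤ} (ht : StrictMono t)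
    (hx : ∀ i k : ℤ, t i ≤ k → k < t (i + 1) → x k = a i) (i : ℤ) (d : ℕ) :
    seqWord x (t i) (t (i + d) - t i).toNat = blockWord ((List.range d).map fun r : ℕ =>
      (a (i + r), (t (i + r + 1) - t (i + r)).toNat)) := by
  induction d with
  | zero => simp [seqWord]
  | succ d ih =>
    have h1 : t i ≤ t (i + d) := ht.monotone (by omega)
    have h2 : t (i + d) < t (i + d + 1) := ht (by omega)
    rw [List.range_succ, List.map_append, blockWord_append, ← ih]
    have h3 : (t (i + (d + 1 : ℕ)) - t i).toNat =
        (t (i + d) - t i).toNat + (t (i + d + 1) - t (i + d)).toNat := by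
      rw [show i + ((d + 1 : ℕ) : ℤ) = i + d + 1 by push_cast; ring]
      omega
    rw [h3, seqWord_add]
    congr 1
    rw [show t i + ((t (i + d) - t i).toNat : ℤ) = t (i + d) by omega]
    simp only [List.map_cons, List.map_nil, blockWord_cons, blockWord_nil, List.append_nil]
    exact seqWord_eq_replicate fun j hj1 hj2 => hx _ j hj1 (by omega)

/-- Every word of a concatenation is a block path with two incomplete blocks around it. -/
lemma exists_eq_of_appears {x : ℤ → V} (hx : x ∈ SGraphCore Adj S) {w : List V}
    (hw : Appears w x) : ∃ (p q : V × ℕ) (l : List (V × ℕ)), IsBlockPath Adj S l ∧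
      w = List.replicate p.2 p.1 ++ blockWord l ++ List.replicate q.2 q.1 := by
  obtain ⟨a, t, ht, hS, hA, hxa, hcov⟩ := hx
  obtain ⟨k, hk⟩ := appears_iff.1 hw
  obtain ⟨i, hi1, hi2⟩ := hcov k
  obtain ⟨j, hj1, hj2⟩ := hcov (k + w.length)
  have hij : i ≤ j := by
    by_contra! h
    have : t (j + 1) ≤ t i := ht.monotone (by omega)
    omega
  rcases hij.eq_or_lt with rfl | hlt
  · refine ⟨(a i, w.length), (a i, 0), [], ⟨List.isChain_nil, by simp⟩, ?_⟩
    rw [hk]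
    simp only [blockWord_nil, List.replicate_zero, List.append_nil]
    rw [show (seqWord x k w.length).length = w.length by simp [seqWord]]
    exact seqWord_eq_replicate fun r h1 h2 => hxa i r (by omega) (by omega)
  · obtain ⟨d, hd⟩ : ∃ d : ℕ, j = i + 1 + d := ⟨(j - (i + 1)).toNat, by omega⟩
    refine ⟨(a i, (t (i + 1) - k).toNat), (a j, (k + w.length - t j).toNat),
      (List.range d).map fun r : ℕ =>
        (a (i + 1 + r), (t (i + 1 + r + 1) - t (i + 1 + r)).toNat), ⟨?_, ?_⟩, ?_⟩
    · rw [List.isChain_map]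
      refine List.isChain_iff_getElem.2 fun r hr => ?_
      simp only [List.getElem_range]
      have := hA (i + 1 + r)
      rwa [show i + 1 + ((r + 1 : ℕ) : ℤ) = i + 1 + r + 1 by push_cast; ring]
    · intro p hp
      obtain ⟨r, -, rfl⟩ := List.mem_map.1 hp
      exact hS _
    · have h1 : t (i + 1) ≤ t j := ht.monotone (by omega)
      rw [← seqWord_eq_blockWord ht hxa (i + 1) d, ← hd]
      have hlen : w.length = (t (i + 1) - k).toNat + (t j - t (i + 1)).toNat +
        (k + w.length - t j).toNat := by omega
      conv_lhs => rw [hk, hlen, seqWord_add, seqWord_add]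
      rw [show k + ((t (i + 1) - k).toNat : ℤ) = t (i + 1) by omega,
        show k + (((t (i + 1) - k).toNat + (t j - t (i + 1)).toNat : ℕ) : ℤ) = t j by omega]
      congr 1
      · congr 1
        exact seqWord_eq_replicate fun r h1 h2 => hxa i r (by omega) (by omega)
      · exact seqWord_eq_replicate fun r h1 h2 => hxa j r (by omega) (by omega)

lemma exists_int_primitive (n : ℤ → ℤ) : ∃ t : ℤ → ℤ, t 0 = 0 ∧ ∀ i, t (i + 1) - t i = n i := by
  refine ⟨fun i => ∑ j ∈ Finset.range i.toNat, n j -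
    ∑ j ∈ Finset.range (-i).toNat, n (-j - 1), by simp, fun i => ?_⟩
  rcases le_or_gt 0 i with h | h
  · obtain ⟨m, rfl⟩ := Int.eq_ofNat_of_zero_le h
    have h1 : ((m : ℤ) + 1).toNat = m + 1 := by omega
    have h2 : (-((m : ℤ) + 1)).toNat = 0 := by omega
    have h3 : (-(m : ℤ)).toNat = 0 := by omega
    simp only [h1, h2, h3, Int.toNat_natCast, Finset.sum_range_succ, Finset.sum_range_zero]
    ring
  · obtain ⟨m, rfl⟩ : ∃ m : ℕ, i = -(m : ℤ) - 1 := ⟨(-i - 1).toNat, by omega⟩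
    have h1 : (-(m : ℤ) - 1 + 1).toNat = 0 := by omega
    have h2 : (-(-(m : ℤ) - 1 + 1)).toNat = m := by omega
    have h3 : (-(m : ℤ) - 1).toNat = 0 := by omega
    have h4 : (-(-(m : ℤ) - 1)).toNat = m + 1 := by omega
    simp only [h1, h2, h3, h4, Finset.sum_range_succ, Finset.sum_range_zero]
    ring

/-- A bi-infinite path of blocks is realised by a point of the core. -/
lemma exists_mem_core (hPos : ∀ v, 0 ∉ S v) {b : ℤ → V × ℕ} (hS : ∀ i, (b i).2 ∈ S (b i).1)
    (hA : ∀ i, Adj (b i).1 (b (i + 1)).1) (d : ℕ) :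
    ∃ x ∈ SGraphCore Adj S, Appears (blockWord ((List.range d).map fun r : ℕ => b r)) x := by
  obtain ⟨t, ht0, ht⟩ := exists_int_primitive fun i => ((b i).2 : ℤ)
  have hpos : ∀ i, 0 < (b i).2 := fun i =>
    Nat.pos_of_ne_zero fun h => hPos _ (h ▸ hS i)
  have hmono : StrictMono t := strictMono_int_of_lt_succ fun i => by
    have := ht i; have := hpos i; omega
  have hup : ∀ n : ℕ, (n : ℤ) ≤ t n := by
    intro n
    induction n with
    | zero => simp [ht0]
    | succ n ih => have := ht n; have := hpos n; push_cast; omega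
  have hdown : ∀ n : ℕ, t (-n) ≤ -n := by
    intro n
    induction n with
    | zero => simp [ht0]
    | succ n ih =>
      have h1 := ht (-(n + 1 : ℕ)); have h2 := hpos (-(n + 1 : ℕ))
      rw [show -((n + 1 : ℕ) : ℤ) + 1 = -n by push_cast; ring] at h1
      push_cast at *
      omega
  have hcov : ∀ m : ℤ, ∃ i : ℤ, t i ≤ m ∧ m < t (i + 1) := by
    intro m
    obtain ⟨i, hi, himax⟩ := Int.exists_greatest_of_bdd (P := fun i => t i ≤ m)
      ⟨(m.natAbs : ℤ), fun z hz => by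
        by_contra! h
        have h1 := hmono h
        have h2 := hup m.natAbs
        omega⟩ ⟨-(m.natAbs : ℤ), (hdown _).trans (by omega)⟩
    refine ⟨i, hi, ?_⟩
    by_contra! h
    have := himax _ h
    omega
  choose idx hidx1 hidx2 using hcov
  have huniq : ∀ i k : ℤ, t i ≤ k → k < t (i + 1) → idx k = i := by
    intro i k h1 h2
    have h3 := hmono.lt_iff_lt.1 (h1.trans_lt (hidx2 k))
    have h4 := hmono.lt_iff_lt.1 ((hidx1 k).trans_lt h2)
    omega
  have hx : ∀ i k : ℤ, t i ≤ k → k < t (i + 1) → (b (idx k)).1 = (b i).1 := by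
    intro i k h1 h2
    rw [huniq i k h1 h2]
  refine ⟨fun k => (b (idx k)).1, ⟨fun i => (b i).1, t, hmono, fun i => ?_, hA, hx,
    fun m => ⟨idx m, hidx1 m, hidx2 m⟩⟩, ?_⟩
  · rw [ht i]
    exact hS i
  · have h := seqWord_eq_blockWord (x := fun k => (b (idx k)).1) (a := fun i => (b i).1)
      hmono hx 0 d
    have h2 : ((List.range d).map fun r : ℕ => b r) = (List.range d).map fun r : ℕ =>
        ((b (0 + r)).1, (t (0 + r + 1) - t (0 + r)).toNat) := by
      refine List.map_congr_left fun r _ => ?_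
      rw [ht]
      simp
    rw [h2, ← h]
    exact seqWord_appears _ _ _

lemma exists_ray (hNe : ∀ v, (S v).Nonempty) (hOut : ∀ v, ∃ w, Adj v w) (l : List (V × ℕ))
    (p : V × ℕ) (hl : IsBlockPath Adj S (p :: l)) : ∃ b : ℕ → V × ℕ, b 0 = p ∧
      (∀ i, (b i).2 ∈ S (b i).1) ∧ (∀ i, Adj (b i).1 (b (i + 1)).1) ∧
      (List.range (l.length + 1)).map b = p :: l := by
  induction l generalizing p with
  | nil =>
    choose s hs using hNe
    choose f hf using hOut
    refine ⟨fun i => if i = 0 then p else (f^[i] p.1, s (f^[i] p.1)), by simp, fun i => ?_,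
      fun i => ?_, by simp⟩
    · by_cases hi : i = 0
      · simpa [hi] using (isBlockPath_cons.1 hl).1
      · simp [hi, hs]
    · by_cases hi : i = 0
      · simp [hi, hf]
      · simp only [hi, if_false, Nat.succ_ne_zero, Function.iterate_succ_apply']
        exact hf _
  | cons q l ih =>
    obtain ⟨hp, hpq, hq⟩ := isBlockPath_cons.1 hl
    obtain ⟨b, hb0, hbS, hbA, hbl⟩ := ih q hq
    refine ⟨fun i => Nat.casesOn i p b, rfl, fun i => ?_, fun i => ?_, ?_⟩
    · cases i with
      | zero => exact hp
      | succ i => exact hbS i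
    · cases i with
      | zero => simpa [hb0] using hpq q (by simp)
      | succ i => exact hbA i
    · rw [List.length_cons, List.range_succ_eq_map, List.map_cons, List.map_map]
      exact congrArg (p :: ·) hbl

lemma exists_appears_blockWord [Nonempty V] (hNe : ∀ v, (S v).Nonempty) (hPos : ∀ v, 0 ∉ S v)
    (hIn : ∀ v, ∃ u, Adj u v) (hOut : ∀ v, ∃ w, Adj v w) {l : List (V × ℕ)}
    (hl : IsBlockPath Adj S l) : ∃ x ∈ SGraphCore Adj S, Appears (blockWord l) x := by
  have hcons : ∀ p l, IsBlockPath Adj S (p :: l) →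
      ∃ x ∈ SGraphCore Adj S, Appears (blockWord (p :: l)) x := by
    intro p l hl
    obtain ⟨b, hb0, hbS, hbA, hbl⟩ := exists_ray hNe hOut l p hl
    choose s hs using hNe
    choose g hg using hIn
    set c : ℤ → V × ℕ := fun i => if 0 ≤ i then b i.toNat else
      (g^[(-i).toNat] p.1, s (g^[(-i).toNat] p.1)) with hc
    have h := exists_mem_core (Adj := Adj) (b := c) hPos (fun i => ?_) (fun i => ?_) (l.length + 1)
    · rw [← hbl]
      simpa [hc] using h
    · simp only [hc]
      split_ifs
      exacts [hbS _, hs _]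
    · rcases le_or_gt 0 i with h | h
      · have h1 : (i + 1).toNat = i.toNat + 1 := by omega
        simp only [hc, h, if_true, show 0 ≤ i + 1 by omega, h1]
        exact hbA _
      · have h0 : (c (i + 1)).1 = g^[(-(i + 1)).toNat] p.1 := by
          rcases eq_or_ne i (-1) with rfl | h'
          · simp [hc, hb0]
          · simp [hc, show ¬ 0 ≤ i + 1 by omega]
        rw [h0]
        have h1 : (-i).toNat = (-(i + 1)).toNat + 1 := by omega
        simp only [hc, h.not_ge, if_false, h1, Function.iterate_succ_apply']
        exact hg _
  cases l with
  | cons p l => exact hcons p l hl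
  | nil =>
    obtain ⟨v⟩ := ‹Nonempty V›
    obtain ⟨s, hs⟩ := hNe v
    obtain ⟨x, hx, -⟩ := hcons (v, s) [] (isBlockPath_cons.2 ⟨hs, by simp, hl⟩)
    exact ⟨x, hx, seqWord_appears x 0 0⟩

lemma inLanguage_closure_iff [TopologicalSpace V] [DiscreteTopology V] {X : Set (ℤ → V)}
    {w : List V} : InLanguage (closure X) w ↔ InLanguage X w := by
  refine ⟨?_, fun ⟨x, hx, hw⟩ => ⟨x, subset_closure hx, hw⟩⟩
  rintro ⟨x, hx, k, hk⟩
  have hopen : IsOpen {y : ℤ → V | ∀ i : Fin w.length, y (k + (i : ℕ)) = w.get i} := by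
    have : {y : ℤ → V | ∀ i : Fin w.length, y (k + (i : ℕ)) = w.get i} =
        ⋂ i : Fin w.length, (fun y : ℤ → V => y (k + (i : ℕ))) ⁻¹' {w.get i} := by
      ext y; simp
    rw [this]
    exact isOpen_iInter_of_finite fun i =>
      (isOpen_discrete _).preimage (continuous_apply _)
  obtain ⟨y, hy, hyX⟩ := mem_closure_iff.1 hx _ hopen hk
  exact ⟨y, hyX, k, hy⟩

end BlockPaths

section Counting

variable {V : Type*} [Fintype V] [DecidableEq V] {Adj : V → V → Prop} {S : V → Set ℕ}

/-- The number of words of length `n` in the language of `X`. -/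
noncomputable def wordCount (X : Set (ℤ → V)) (n : ℕ) : ℕ :=
  {w : List V | w.length = n ∧ InLanguage X w}.ncard

open scoped Classical in
/-- The total weight of the block paths with `k` blocks that can be entered from `u`. -/
noncomputable def pathWeight (Adj : V → V → Prop) (S : V → Set ℕ) (y : ENNReal) (k : ℕ) (u : V) :
    ENNReal :=
  ∑' l : List (V × ℕ), if l.length = k ∧ IsBlockPath Adj S l ∧ ∀ q ∈ l.head?, Adj u q.1 then
    y ^ (blockWord l).length else 0

omit [Fintype V] [DecidableEq V] in
lemma pathWeight_zero (y : ENNReal) (u : V) : pathWeight Adj S y 0 u = 1 := by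
  rw [pathWeight, tsum_eq_single []]
  · simp [IsBlockPath]
  · intro l hl
    rw [if_neg fun h => hl (List.length_eq_zero_iff.1 h.1)]

omit [DecidableEq V] in
open scoped Classical in
lemma pathWeight_succ (y : ENNReal) (k : ℕ) (u : V) :
    pathWeight Adj S y (k + 1) u =
      ∑ v, (if Adj u v then ∑' s : S v, y ^ (s : ℕ) else 0) * pathWeight Adj S y k v := by
  have hinj : Function.Injective fun p : (V × ℕ) × List (V × ℕ) => p.1 :: p.2 := by
    rintro ⟨p, l⟩ ⟨q, l'⟩ h
    simpa using h
  rw [pathWeight, ← hinj.tsum_eq, ENNReal.tsum_prod', ENNReal.tsum_prod', tsum_fintype]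
  · refine Finset.sum_congr rfl fun v _ => ?_
    have hS : (if Adj u v then ∑' s : S v, y ^ (s : ℕ) else 0) =
        ∑' n : ℕ, if Adj u v ∧ n ∈ S v then y ^ n else 0 := by
      split_ifs with h
      · rw [tsum_subtype (S v) fun n => y ^ n]
        simp [h, Set.indicator_apply]
      · simp [h]
    rw [hS, ← ENNReal.tsum_mul_right]
    refine tsum_congr fun n => ?_
    rw [pathWeight, ← ENNReal.tsum_mul_left]
    refine tsum_congr fun l => ?_
    simp only [isBlockPath_cons, List.length_cons, Nat.add_right_cancel_iff, List.head?_cons,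
      Option.mem_some_iff, forall_eq', blockWord_cons, List.length_append, List.length_replicate,
      pow_add]
    by_cases h1 : Adj u v ∧ n ∈ S v
    · by_cases h2 : l.length = k ∧ IsBlockPath Adj S l ∧ ∀ q ∈ l.head?, Adj v q.1
      · rw [if_pos h1, if_pos h2, if_pos (by tauto)]
      · rw [if_neg h2, mul_zero, if_neg (by tauto)]
    · rw [if_neg h1, zero_mul, if_neg (by tauto)]
  · intro l hl
    cases l with
    | nil => simp at hl
    | cons p l => exact ⟨(p, l), rfl⟩

lemma pathWeight_eq {x : ℝ} (h0 : 0 ≤ x) (h1 : x < 1) (k : ℕ) (u : V) :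
    pathWeight Adj S (ENNReal.ofReal x) k u =
      ENNReal.ofReal (∑ v, ((edgeMatrix Adj fun v => genFun S v x) ^ k) u v) := by
  have hnn : ∀ v, 0 ≤ genFun S v x := fun v => genFun_nonneg v h0
  induction k generalizing u with
  | zero => simp [pathWeight_zero, Matrix.one_apply]
  | succ k ih =>
    rw [pathWeight_succ]
    simp only [pow_succ', Matrix.mul_apply]
    rw [Finset.sum_comm]
    simp only [← Finset.mul_sum]
    rw [ENNReal.ofReal_sum_of_nonneg fun v _ => mul_nonneg (edgeMatrix_nonneg hnn _ _)
      (Finset.sum_nonneg fun w _ => Matrix.pow_apply_nonneg (edgeMatrix_nonneg hnn) _ _ _)]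
    refine Finset.sum_congr rfl fun v _ => ?_
    rw [ENNReal.ofReal_mul (edgeMatrix_nonneg hnn _ _), ih]
    congr 1
    by_cases h : Adj u v
    · rw [if_pos h, edgeMatrix_apply_of_adj _ h, genFun,
        ENNReal.ofReal_tsum_of_nonneg (fun _ => pow_nonneg h0 _) (summable_pow_subtype _ h0 h1)]
      simp [ENNReal.ofReal_pow h0]
    · simp [h, edgeMatrix]

omit [Fintype V] [DecidableEq V] in
lemma tsum_pathWeight (y : ENNReal) (u : V) :
    ∑' k, pathWeight Adj S y k u =
      ∑' l : {l : List (V × ℕ) | IsBlockPath Adj S l ∧ ∀ q ∈ l.head?, Adj u q.1},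
        y ^ (blockWord l.1).length := by
  classical
  rw [tsum_subtype _ fun l : List (V × ℕ) => y ^ (blockWord l).length]
  simp only [pathWeight]
  rw [ENNReal.tsum_comm]
  refine tsum_congr fun l => ?_
  rw [tsum_eq_single l.length]
  · simp [Set.indicator_apply]
  · intro k hk
    rw [if_neg fun h => hk h.1.symm]

omit [Fintype V] [DecidableEq V] in
lemma tsum_pathWeight_le (y : ENNReal) (u : V) :
    ∑' k, pathWeight Adj S y k u ≤
      ∑' l : {l : List (V × ℕ) | IsBlockPath Adj S l}, y ^ (blockWord l.1).length := by
  rw [tsum_pathWeight]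
  exact ENNReal.tsum_mono_subtype (fun l : List (V × ℕ) => y ^ (blockWord l).length)
    fun l hl => hl.1

omit [DecidableEq V] in
lemma tsum_blockPath_le [Nonempty V] (hIn : ∀ v, ∃ u, Adj u v) (y : ENNReal) :
    ∑' l : {l : List (V × ℕ) | IsBlockPath Adj S l}, y ^ (blockWord l.1).length ≤
      ∑ u, ∑' k, pathWeight Adj S y k u := by
  simp only [tsum_pathWeight]
  have hcover : {l : List (V × ℕ) | IsBlockPath Adj S l} ⊆
      ⋃ u, {l : List (V × ℕ) | IsBlockPath Adj S l ∧ ∀ q ∈ l.head?, Adj u q.1} := by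
    intro l hl
    refine Set.mem_iUnion.2 ?_
    cases l with
    | nil => exact ⟨Classical.arbitrary V, hl, by simp⟩
    | cons p l =>
      obtain ⟨u, hu⟩ := hIn p.1
      exact ⟨u, hl, by simpa using hu⟩
  refine (ENNReal.tsum_mono_subtype (fun l : List (V × ℕ) => y ^ (blockWord l).length)
    hcover).trans ?_
  refine (ENNReal.tsum_iUnion_le_tsum (fun l : List (V × ℕ) => y ^ (blockWord l).length)
    _).trans ?_
  rw [tsum_fintype]

omit [DecidableEq V] in
lemma finite_words (X : Set (ℤ → V)) (n : ℕ) :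
    {w : List V | w.length = n ∧ InLanguage X w}.Finite :=
  (List.finite_length_eq V n).subset fun _ hw => hw.1

omit [DecidableEq V] in
lemma tsum_language (X : Set (ℤ → V)) (y : ENNReal) :
    ∑' w : {w : List V // InLanguage X w}, y ^ w.1.length =
      ∑' n, (wordCount X n : ENNReal) * y ^ n := by
  rw [← (Equiv.sigmaFiberEquiv fun w : {w : List V // InLanguage X w} => w.1.length).tsum_eq,
    ENNReal.tsum_sigma']
  refine tsum_congr fun n => ?_
  have hterm : ∀ w : {w : {w : List V // InLanguage X w} // w.1.length = n},
      y ^ ((Equiv.sigmaFiberEquiv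
        fun w : {w : List V // InLanguage X w} => w.1.length) ⟨n, w⟩).1.length = y ^ n := by
    rintro ⟨w, hw⟩
    simp [hw]
  rw [tsum_congr hterm, ENNReal.tsum_const]
  congr 1
  have e : {w : {w : List V // InLanguage X w} // w.1.length = n} ≃
      {w : List V | w.length = n ∧ InLanguage X w} :=
    (Equiv.subtypeSubtypeEquivSubtypeInter _ fun w : List V => w.length = n).trans
      (Equiv.subtypeEquivRight fun w => and_comm)
  rw [ENat.card_congr e, wordCount]
  rw [← Set.encard, ← (finite_words X n).cast_ncard_eq]
  rfl

omit [DecidableEq V] in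
lemma tsum_blockPath_le_tsum_wordCount [Nonempty V] (hLoop : ∀ v, ¬ Adj v v)
    (hNe : ∀ v, (S v).Nonempty) (hPos : ∀ v, 0 ∉ S v) (hIn : ∀ v, ∃ u, Adj u v)
    (hOut : ∀ v, ∃ w, Adj v w) (y : ENNReal) :
    ∑' l : {l : List (V × ℕ) | IsBlockPath Adj S l}, y ^ (blockWord l.1).length ≤
      ∑' n, (wordCount (SGraphCore Adj S) n : ENNReal) * y ^ n := by
  rw [← tsum_language]
  have hinj : Function.Injective fun l : {l : List (V × ℕ) | IsBlockPath Adj S l} =>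
      (⟨blockWord l.1, exists_appears_blockWord hNe hPos hIn hOut l.2⟩ :
        {w : List V // InLanguage (SGraphCore Adj S) w}) := by
    intro l l' h
    exact Subtype.ext (blockWord_injOn hLoop hPos l.2 l'.2 (congrArg Subtype.val h))
  exact ENNReal.tsum_comp_le_tsum_of_injective hinj fun w => y ^ w.1.length

omit [DecidableEq V] in
lemma tsum_wordCount_le (y : ENNReal) :
    ∑' n, (wordCount (SGraphCore Adj S) n : ENNReal) * y ^ n ≤
      (∑' p : V × ℕ, y ^ p.2) *
        (∑' l : {l : List (V × ℕ) | IsBlockPath Adj S l}, y ^ (blockWord l.1).length) *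
        ∑' p : V × ℕ, y ^ p.2 := by
  rw [← tsum_language]
  have h : ∀ w : {w : List V // InLanguage (SGraphCore Adj S) w},
      ∃ z : ((V × ℕ) × {l : List (V × ℕ) | IsBlockPath Adj S l}) × (V × ℕ),
        w.1 = List.replicate z.1.1.2 z.1.1.1 ++ blockWord z.1.2.1 ++
          List.replicate z.2.2 z.2.1 := by
    rintro ⟨w, x, hx, hw⟩
    obtain ⟨p, q, l, hl, rfl⟩ := exists_eq_of_appears hx hw
    exact ⟨((p, ⟨l, hl⟩), q), rfl⟩
  choose φ hφ using h
  have hinj : Function.Injective φ := fun w w' hww =>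
    Subtype.ext (by rw [hφ w, hφ w', hww])
  calc ∑' w : {w : List V // InLanguage (SGraphCore Adj S) w}, y ^ w.1.length
      = ∑' w, y ^ (φ w).1.1.2 * y ^ (blockWord (φ w).1.2.1).length * y ^ (φ w).2.2 := by
        refine tsum_congr fun w => ?_
        rw [hφ w]
        simp [pow_add, mul_assoc]
    _ ≤ ∑' z : ((V × ℕ) × {l : List (V × ℕ) | IsBlockPath Adj S l}) × (V × ℕ),
          y ^ z.1.1.2 * y ^ (blockWord z.1.2.1).length * y ^ z.2.2 :=
        ENNReal.tsum_comp_le_tsum_of_injective hinj fun z =>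
          y ^ z.1.1.2 * y ^ (blockWord z.1.2.1).length * y ^ z.2.2
    _ = _ := by
        rw [ENNReal.tsum_prod', ENNReal.tsum_prod']
        simp only [ENNReal.tsum_mul_left, ENNReal.tsum_mul_right]

lemma tsum_wordCount_ne_top [Nonempty V] (hIn : ∀ v, ∃ u, Adj u v) {x : ℝ} (h0 : 0 ≤ x)
    (h1 : x < 1)
    (hs : ∀ u v, Summable fun k => ((edgeMatrix Adj fun v => genFun S v x) ^ k) u v) :
    ∑' n, (wordCount (SGraphCore Adj S) n : ENNReal) * ENNReal.ofReal x ^ n ≠ ⊤ := by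
  have hgeom : ∑' p : V × ℕ, ENNReal.ofReal x ^ p.2 ≠ ⊤ := by
    rw [ENNReal.tsum_prod']
    simp only [ENNReal.tsum_geometric, tsum_fintype, Finset.sum_const, nsmul_eq_mul]
    refine ENNReal.mul_ne_top (ENNReal.natCast_ne_top _) (ENNReal.inv_ne_top.2 ?_)
    rw [← ENNReal.ofReal_one, ← ENNReal.ofReal_sub _ h0]
    simpa using h1
  have hpath : ∑' l : {l : List (V × ℕ) | IsBlockPath Adj S l},
      ENNReal.ofReal x ^ (blockWord l.1).length ≠ ⊤ := by
    refine ne_top_of_le_ne_top ?_ (tsum_blockPath_le hIn _)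
    refine (ENNReal.sum_lt_top.2 fun u _ => ?_).ne
    simp only [pathWeight_eq h0 h1]
    exact lt_top_iff_ne_top.2 (summable_sum fun v _ => hs u v).tsum_ofReal_ne_top
  exact ne_top_of_le_ne_top (ENNReal.mul_ne_top (ENNReal.mul_ne_top hgeom hpath) hgeom)
    (tsum_wordCount_le _)

lemma Matrix.det_one_sub_ne_zero_of_tendsto {A : Matrix V V ℝ} (hA : ∀ u v, 0 ≤ A u v)
    (h : ∀ u, Tendsto (fun k => ∑ v, (A ^ k) u v) atTop (𝓝 0)) : (1 - A).det ≠ 0 := by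
  intro hdet
  obtain ⟨f, hf0, hf⟩ := Matrix.exists_mulVec_eq_zero_iff.2 hdet
  have hfix : A.mulVec f = f := by
    rw [Matrix.sub_mulVec, Matrix.one_mulVec, sub_eq_zero] at hf
    exact hf.symm
  have hpow : ∀ k : ℕ, (A ^ k).mulVec f = f := by
    intro k
    induction k with
    | zero => simp
    | succ k ih => rw [pow_succ, ← Matrix.mulVec_mulVec, hfix, ih]
  refine hf0 (funext fun u => ?_)
  have hbound : ∀ k : ℕ, |f u| ≤ (∑ v, (A ^ k) u v) * ∑ v, |f v| := by
    intro k
    conv_lhs => rw [← hpow k]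
    rw [Matrix.mulVec, dotProduct, Finset.sum_mul]
    refine (Finset.abs_sum_le_sum_abs _ _).trans (Finset.sum_le_sum fun v _ => ?_)
    rw [abs_mul, abs_of_nonneg (Matrix.pow_apply_nonneg hA k u v)]
    exact mul_le_mul_of_nonneg_left
      (Finset.single_le_sum (f := fun v => |f v|) (fun _ _ => abs_nonneg _) (Finset.mem_univ v))
      (Matrix.pow_apply_nonneg hA k u v)
  have hlim := (h u).mul_const (∑ v, |f v|)
  rw [zero_mul] at hlim
  exact abs_nonpos_iff.1 (ge_of_tendsto' hlim hbound)

lemma det_ne_zero_of_summable_wordCount [Nonempty V] (hLoop : ∀ v, ¬ Adj v v)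
    (hNe : ∀ v, (S v).Nonempty) (hPos : ∀ v, 0 ∉ S v) (hIn : ∀ v, ∃ u, Adj u v)
    (hOut : ∀ v, ∃ w, Adj v w) {x : ℝ} (h0 : 0 ≤ x) (h1 : x < 1)
    (hs : Summable fun n => (wordCount (SGraphCore Adj S) n : ℝ) * x ^ n) :
    (1 - edgeMatrix Adj fun v => genFun S v x).det ≠ 0 := by
  have hnn : ∀ u v, 0 ≤ edgeMatrix Adj (fun v => genFun S v x) u v :=
    edgeMatrix_nonneg fun v => genFun_nonneg v h0
  refine Matrix.det_one_sub_ne_zero_of_tendsto hnn fun u => ?_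
  have htop : ∑' n, (wordCount (SGraphCore Adj S) n : ENNReal) * ENNReal.ofReal x ^ n ≠ ⊤ := by
    convert hs.tsum_ofReal_ne_top using 4 with n
    rw [ENNReal.ofReal_mul (Nat.cast_nonneg _), ENNReal.ofReal_natCast, ENNReal.ofReal_pow h0]
  have hsum : ∑' k, pathWeight Adj S (ENNReal.ofReal x) k u ≠ ⊤ :=
    ne_top_of_le_ne_top htop ((tsum_pathWeight_le _ u).trans
      (tsum_blockPath_le_tsum_wordCount hLoop hNe hPos hIn hOut _))
  have hlim := (ENNReal.tendsto_toReal ENNReal.zero_ne_top).comp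
    (ENNReal.tendsto_atTop_zero_of_tsum_ne_top hsum)
  refine hlim.congr fun k => ?_
  rw [Function.comp_apply, pathWeight_eq h0 h1, ENNReal.toReal_ofReal]
  exact Finset.sum_nonneg fun v _ => Matrix.pow_apply_nonneg hnn _ _ _

end Counting

section Entropy

variable {V : Type*}

lemma InLanguage.of_append {X : Set (ℤ → V)} {w w' : List V} (h : InLanguage X (w ++ w')) :
    InLanguage X w ∧ InLanguage X w' := by
  obtain ⟨x, hx, hw⟩ := h
  obtain ⟨k, hk⟩ := appears_iff.1 hw
  rw [List.length_append, seqWord_add] at hk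
  obtain ⟨h1, h2⟩ := List.append_inj hk (by simp [seqWord])
  exact ⟨⟨x, hx, appears_iff.2 ⟨k, h1⟩⟩, ⟨x, hx, appears_iff.2 ⟨_, h2⟩⟩⟩

variable [Fintype V]

lemma wordCount_add_le (X : Set (ℤ → V)) (m n : ℕ) :
    wordCount X (m + n) ≤ wordCount X m * wordCount X n := by
  have hfin := (finite_words X m).prod (finite_words X n)
  rw [wordCount, wordCount, wordCount, ← Set.ncard_prod]
  refine le_trans (Set.ncard_le_ncard (t := (fun p : List V × List V => p.1 ++ p.2) ''
    ({w : List V | w.length = m ∧ InLanguage X w} ×ˢ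
      {w : List V | w.length = n ∧ InLanguage X w})) ?_ (hfin.image _)) (Set.ncard_image_le hfin)
  rintro w ⟨hw, hX⟩
  rw [← List.take_append_drop m w] at hX
  obtain ⟨h1, h2⟩ := hX.of_append
  exact ⟨(w.take m, w.drop m), ⟨⟨by simp [hw], h1⟩, ⟨by simp [hw], h2⟩⟩,
    List.take_append_drop m w⟩

lemma wordCount_pos {X : Set (ℤ → V)} (hX : X.Nonempty) (n : ℕ) : 0 < wordCount X n := by
  obtain ⟨x, hx⟩ := hX
  refine (Set.ncard_pos (finite_words X n)).2 ⟨seqWord x 0 n, by simp [seqWord], x, hx, ?_⟩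
  exact seqWord_appears x 0 n

lemma subadditive_log_wordCount {X : Set (ℤ → V)} (hX : X.Nonempty) :
    Subadditive fun n => Real.log (wordCount X n) := by
  intro m n
  have hm : (0 : ℝ) < wordCount X m := Nat.cast_pos.2 (wordCount_pos hX m)
  have hn : (0 : ℝ) < wordCount X n := Nat.cast_pos.2 (wordCount_pos hX n)
  rw [← Real.log_mul hm.ne' hn.ne']
  refine Real.log_le_log (Nat.cast_pos.2 (wordCount_pos hX _)) ?_
  exact_mod_cast wordCount_add_le X m n

/-- The entropy `h` exists; it is nonnegative, `exp (h * n)` bounds the number of words from below,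
and the growth series converges at every point below `exp (-h)`. -/
lemma exists_entropy {X : Set (ℤ → V)} (hX : X.Nonempty) : ∃ h : ℝ, 0 ≤ h ∧
    Tendsto (fun n : ℕ => Real.log (wordCount X n) / n) atTop (𝓝 h) ∧
    (∀ n : ℕ, Real.exp (h * n) ≤ wordCount X n) ∧
    ∀ x : ℝ, 0 < x → x < Real.exp (-h) → Summable fun n => (wordCount X n : ℝ) * x ^ n := by
  have hsub := subadditive_log_wordCount hX
  have hone : ∀ n, (1 : ℝ) ≤ wordCount X n := fun n => by
    exact_mod_cast wordCount_pos hX n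
  have hnn : ∀ n : ℕ, 0 ≤ Real.log (wordCount X n) / n := fun n =>
    div_nonneg (Real.log_nonneg (hone n)) (Nat.cast_nonneg n)
  have hbdd : BddBelow (Set.range fun n : ℕ => Real.log (wordCount X n) / n) := by
    refine ⟨0, ?_⟩
    rintro _ ⟨n, rfl⟩
    exact hnn n
  have hlim := hsub.tendsto_lim hbdd
  refine ⟨hsub.lim, ge_of_tendsto' hlim hnn, hlim, fun n => ?_, fun x hx0 hx => ?_⟩
  · rcases Nat.eq_zero_or_pos n with rfl | hn
    · simpa using hone 0
    · rw [← Real.le_log_iff_exp_le (zero_lt_one.trans_le (hone n)),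
        ← le_div_iff₀ (Nat.cast_pos.2 hn)]
      exact hsub.lim_le_div hbdd hn.ne'
  · have hx' : hsub.lim < -Real.log x := by
      have := (Real.log_lt_iff_lt_exp hx0).2 hx
      linarith
    obtain ⟨r, hr1, hr2⟩ := exists_between hx'
    refine Summable.of_norm_bounded_eventually_nat (g := fun n => (Real.exp r * x) ^ n)
      (summable_geometric_of_lt_one (by positivity) ?_) ?_
    · rw [← Real.exp_log hx0, ← Real.exp_add, Real.exp_lt_one_iff]
      linarith
    · filter_upwards [hlim.eventually_lt_const hr1, eventually_gt_atTop 0] with n hn hn0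
      rw [Real.norm_of_nonneg (by positivity), mul_pow, ← Real.exp_nat_mul]
      refine mul_le_mul_of_nonneg_right ?_ (by positivity)
      rw [div_lt_iff₀ (Nat.cast_pos.2 hn0), Real.log_lt_iff_lt_exp
        (zero_lt_one.trans_le (hone n)), mul_comm] at hn
      exact hn.le

end Entropy

/-- **Power-series form of the entropy formula.**  Let `(G,S)` be an essential
set-equipped graph.  If `λ` is the least positive solution of
`∑_{C ∈ C_G} (−1)^{|C|+1} ∏_{c ∈ C} H_c(x) = 1`, then the entropy of `X(G,S)` is
`log (1/λ)`. -/
theorem entropy_SGraphShift_cycles {V : Type*} [Fintype V] [DecidableEq V] [Nonempty V]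
    [TopologicalSpace V] [DiscreteTopology V]
    (Adj : V → V → Prop) (S : V → Set ℕ)
    (hLoop : ∀ v, ¬ Adj v v)
    (hNe : ∀ v, (S v).Nonempty) (hPos : ∀ v, 0 ∉ S v)
    (hEss : ∀ v : V, (∃ u, Adj u v) ∧ (∃ w, Adj v w))
    (lam : ℝ) (hpos : 0 < lam) (hsol : cycleSum Adj S lam = 1)
    (hleast : ∀ y : ℝ, 0 < y → cycleSum Adj S y = 1 → lam ≤ y) :
    HasEntropy (closure (SGraphCore Adj S)) (Real.log (1 / lam)) := by
  have hIn : ∀ v, ∃ u, Adj u v := fun v => (hEss v).1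
  have hOut : ∀ v, ∃ w, Adj v w := fun v => (hEss v).2
  have hX : (SGraphCore Adj S).Nonempty := by
    obtain ⟨x, hx, -⟩ := exists_appears_blockWord (l := []) hNe hPos hIn hOut
      ⟨List.isChain_nil, by simp⟩
    exact ⟨x, hx⟩
  have hlam1 : lam ≤ 1 := by
    obtain ⟨x, hx, hx1⟩ := exists_cycleSum_eq_one hLoop hNe hPos hOut
    exact (hleast x hx.1 hx1).trans hx.2
  obtain ⟨h, h0, hlim, hlow, hsummable⟩ := exists_entropy hX
  have hexp : Real.exp (-h) = lam := by
    refine le_antisymm ?_ ?_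
    · by_contra! hlt
      have hlt1 : lam < 1 := hlt.trans_le (Real.exp_le_one_iff.2 (by linarith))
      refine det_ne_zero_of_summable_wordCount hLoop hNe hPos hIn hOut hpos.le hlt1
        (hsummable lam hpos hlt) ?_
      rw [det_one_sub_edgeMatrix_genFun hLoop, hsol, sub_self]
    · by_contra! hlt
      set x := Real.exp (-h) with hx
      have hx0 : 0 < x := Real.exp_pos _
      have hx1 : x < 1 := hlt.trans_le hlam1
      have hs := summable_edgeMatrix_pow (Adj := Adj) (H := fun v x => genFun S v x) hx0.le
        (fun v => continuousOn_genFun v hx1) (fun v y hy => genFun_nonneg v hy.1)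
        (genFun_zero hPos) fun y hy => by
          rw [det_one_sub_edgeMatrix_genFun hLoop, sub_ne_zero]
          exact fun heq => absurd (hleast y hy.1 heq.symm) (hy.2.trans_lt hlt).not_ge
      have ht := ENNReal.tendsto_atTop_zero_of_tsum_ne_top (tsum_wordCount_ne_top hIn hx0.le hx1 hs)
      obtain ⟨n, hn⟩ := (ht.eventually_lt_const zero_lt_one).exists
      rw [← ENNReal.ofReal_pow hx0.le, ← ENNReal.ofReal_natCast,
        ← ENNReal.ofReal_mul (Nat.cast_nonneg _), ENNReal.ofReal_lt_one] at hn
      have h2 := mul_le_mul_of_nonneg_right (hlow n) (pow_nonneg hx0.le n)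
      rw [hx, ← Real.exp_nat_mul, ← Real.exp_add, show h * n + n * -h = 0 by ring,
        Real.exp_zero] at h2
      rw [hx, ← Real.exp_nat_mul] at hn
      linarith
  rw [one_div, Real.log_inv, ← hexp, Real.log_exp, neg_neg]
  unfold HasEntropy
  simp only [inLanguage_closure_iff]
  exact hlim
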